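/- Assume λ > 0, v₀ ∈ ℝ, μ satisfies (aa) and (f1), and let v(t) = v₀ (λ/π) ∫₀^∞ (e^{−rt}/r) G(r) dr. Suppose there exist ϑ ∈ (0,1) and κ, a, β, m > 0 such that μ(α) ≤ a α^κ e^{−β/α^m} for a.e. α ∈ (0, ϑ). Then for every q ∈ (0,1) there exist c > 0 and T₀ > 1 such that for all t ≥ T₀: |v(t)| ≤ c · Γ(κ+1) / [ (1−q)^{κ+1} (ln t)^{κ+1} ] · exp( − m^{1/(m+1)} (1 + 1/m) (q^m β)^{1/(m+1)} (ln t)^{m/(m+1)} ). -/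

import Mathlib

open MeasureTheory Set Real

/-- The function `G(r)` from formula (g1). -/
noncomputable def Gfun (μ : ℝ → ℝ) (lam : ℝ) (r : ℝ) : ℝ :=
  (∫ α in Ioo (0:ℝ) 1, r ^ α * Real.sin (π * α) * μ α) /
    ((lam + ∫ α in Ioo (0:ℝ) 1, r ^ α * Real.cos (π * α) * μ α) ^ 2 +
      (∫ α in Ioo (0:ℝ) 1, r ^ α * Real.sin (π * α) * μ α) ^ 2)

/-- The function `v` from formula (postacv), the solution of `D^(μ)v + λv = 0`, `v(0)=v₀`. -/
noncomputable def vfun (μ : ℝ → ℝ) (lam v₀ : ℝ) (t : ℝ) : ℝ :=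
  v₀ * (lam / π) * ∫ r in Ioi (0:ℝ), (Real.exp (-r * t) / r) * Gfun μ lam r

theorem sin_pi_mul_mul_Gamma_le {α : ℝ} (hα : α ∈ Ioo (0:ℝ) 1) :
    Real.sin (π * α) * Real.Gamma α ≤ π := by
  have h0 := hα.1
  have hΓ : Real.Gamma (α + 1) ≤ 1 := by
    have h := Real.convexOn_Gamma.2 (show (1:ℝ) ∈ Ioi 0 by simp) (show (2:ℝ) ∈ Ioi 0 by simp)
      (sub_nonneg.2 hα.2.le) h0.le (by ring)
    simp only [smul_eq_mul, Real.Gamma_one, Real.Gamma_two] at h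
    rw [show (1 - α) * 1 + α * 2 = α + 1 by ring] at h
    linarith
  have hs : Real.sin (π * α) ≤ π * α := Real.sin_le (by positivity)
  calc Real.sin (π * α) * Real.Gamma α ≤ π * α * Real.Gamma α :=
        mul_le_mul_of_nonneg_right hs (Real.Gamma_pos_of_pos h0).le
    _ = π * Real.Gamma (α + 1) := by rw [Real.Gamma_add_one h0.ne']; ring
    _ ≤ π := mul_le_of_le_one_right pi_pos.le hΓ

theorem sin_pi_mul_pos {α : ℝ} (hα : α ∈ Ioo (0:ℝ) 1) : 0 < Real.sin (π * α) :=
  Real.sin_pos_of_pos_of_lt_pi (mul_pos pi_pos hα.1)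
    (by nlinarith [hα.2, pi_pos])

theorem integrableOn_rpow_mul_exp_neg_mul {s b : ℝ} (hs : -1 < s) (hb : 0 < b) :
    IntegrableOn (fun x : ℝ => x ^ s * Real.exp (-(b * x))) (Ioi 0) := by
  simpa using integrableOn_rpow_mul_exp_neg_mul_rpow hs one_pos hb

/-- The weight `r ^ α` and a bounded measurable factor times an integrable function is integrable on `(0,1)`. -/
theorem integrableOn_rpow_mul_mul {μ : ℝ → ℝ} (hint : IntegrableOn μ (Ioo 0 1)) {g : ℝ → ℝ}
    (hg : Measurable g) (hg1 : ∀ α, |g α| ≤ 1) {r : ℝ} (hr : 0 < r) :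
    IntegrableOn (fun α => r ^ α * g α * μ α) (Ioo 0 1) := by
  refine Integrable.bdd_mul (c := max 1 r) hint (by fun_prop) ?_
  filter_upwards [ae_restrict_mem measurableSet_Ioo] with α hα
  have h : r ^ α ≤ max 1 r := by
    rcases le_total r 1 with h | h
    · exact (Real.rpow_le_one hr.le h hα.1.le).trans (le_max_left _ _)
    · exact (Real.rpow_le_self_of_one_le h hα.2.le).trans (le_max_right _ _)
  rw [norm_mul, Real.norm_eq_abs, Real.norm_eq_abs, abs_of_pos (Real.rpow_pos_of_pos hr α)]
  exact (mul_le_of_le_one_right (Real.rpow_pos_of_pos hr α).le (hg1 α)).trans h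

theorem integral_sin_mul_pos {μ : ℝ → ℝ} (hnn : ∀ α ∈ Icc (0:ℝ) 1, 0 ≤ μ α)
    (hint : IntegrableOn μ (Ioo 0 1)) (hpos : 0 < ∫ α in Ioo (0:ℝ) 1, μ α) :
    0 < ∫ α in Ioo (0:ℝ) 1, Real.sin (π * α) * μ α := by
  have hnn' : 0 ≤ᵐ[volume.restrict (Ioo (0:ℝ) 1)] μ := by
    filter_upwards [ae_restrict_mem measurableSet_Ioo] with α hα using hnn α (Ioo_subset_Icc_self hα)
  rw [setIntegral_pos_iff_support_of_nonneg_ae hnn' hint] at hpos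
  rw [setIntegral_pos_iff_support_of_nonneg_ae]
  · convert hpos using 2
    ext α
    simp only [mem_inter_iff, Function.mem_support, ne_eq, mul_eq_zero, not_or]
    exact ⟨fun h => ⟨h.1.2, h.2⟩, fun h => ⟨⟨(sin_pi_mul_pos h.2).ne', h.1⟩, h.2⟩⟩
  · filter_upwards [ae_restrict_mem measurableSet_Ioo] with α hα
      using mul_nonneg (sin_pi_mul_pos hα).le (hnn α (Ioo_subset_Icc_self hα))
  · simpa using integrableOn_rpow_mul_mul hint (g := fun α => Real.sin (π * α)) (by fun_prop)
      (fun α => Real.abs_sin_le_one _) one_pos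

theorem integral_rpow_mul_sin_nonneg {μ : ℝ → ℝ} (hnn : ∀ α ∈ Icc (0:ℝ) 1, 0 ≤ μ α)
    {r : ℝ} (hr : 0 < r) :
    0 ≤ ∫ α in Ioo (0:ℝ) 1, r ^ α * Real.sin (π * α) * μ α :=
  setIntegral_nonneg measurableSet_Ioo fun α hα =>
    mul_nonneg (mul_nonneg (Real.rpow_nonneg hr.le α) (sin_pi_mul_pos hα).le)
      (hnn α (Ioo_subset_Icc_self hα))

theorem Gfun_nonneg {μ : ℝ → ℝ} (hnn : ∀ α ∈ Icc (0:ℝ) 1, 0 ≤ μ α) (lam : ℝ)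
    {r : ℝ} (hr : 0 < r) : 0 ≤ Gfun μ lam r :=
  div_nonneg (integral_rpow_mul_sin_nonneg hnn hr) (by positivity)

theorem abs_integral_rpow_mul_cos_le {μ : ℝ → ℝ} (hnn : ∀ α ∈ Icc (0:ℝ) 1, 0 ≤ μ α)
    (hf1 : IntegrableOn (fun α => μ α / α) (Ioo 0 1)) {L : ℝ} (hL : 0 < L) :
    |∫ α in Ioo (0:ℝ) 1, Real.exp (-L) ^ α * Real.cos (π * α) * μ α| ≤
      (∫ α in Ioo (0:ℝ) 1, μ α / α) / L := by
  rw [← integral_div, ← Real.norm_eq_abs]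
  refine norm_integral_le_of_norm_le (hf1.div_const L) ?_
  filter_upwards [ae_restrict_mem measurableSet_Ioo] with α hα
  have hμ := hnn α (Ioo_subset_Icc_self hα)
  have h0 := hα.1
  have he : Real.exp (-L) ^ α ≤ 1 / (α * L) := by
    rw [← Real.exp_mul, le_div_iff₀ (by positivity), neg_mul, Real.exp_neg,
      inv_mul_le_iff₀ (Real.exp_pos _)]
    linarith [Real.add_one_le_exp (L * α)]
  rw [norm_mul, norm_mul, Real.norm_eq_abs, Real.norm_eq_abs, Real.norm_eq_abs, abs_of_nonneg hμ,
    abs_of_nonneg (Real.rpow_nonneg (Real.exp_pos _).le α)]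
  calc Real.exp (-L) ^ α * |Real.cos (π * α)| * μ α
      ≤ 1 / (α * L) * 1 * μ α := by
        gcongr
        exact Real.abs_cos_le_one _
    _ = μ α / α / L := by field_simp

/-- `G` is bounded by a multiple of its numerator. -/
theorem exists_Gfun_le {μ : ℝ → ℝ} {lam : ℝ} (hlam : 0 < lam)
    (hnn : ∀ α ∈ Icc (0:ℝ) 1, 0 ≤ μ α) (hint : IntegrableOn μ (Ioo 0 1))
    (hpos : 0 < ∫ α in Ioo (0:ℝ) 1, μ α)
    (hf1 : IntegrableOn (fun α => μ α / α) (Ioo 0 1)) :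
    ∃ A > 0, ∀ r > 0, Gfun μ lam r ≤ A * ∫ α in Ioo (0:ℝ) 1, r ^ α * Real.sin (π * α) * μ α := by
  have hs := integral_sin_mul_pos hnn hint hpos
  set s := ∫ α in Ioo (0:ℝ) 1, Real.sin (π * α) * μ α with hsdef
  set d := ∫ α in Ioo (0:ℝ) 1, μ α / α with hd
  have hd0 : 0 ≤ d := setIntegral_nonneg measurableSet_Ioo fun α hα =>
    div_nonneg (hnn α (Ioo_subset_Icc_self hα)) hα.1.le
  set L₀ := 2 * d / lam + 1 with hL₀
  have hL₀pos : 0 < L₀ := by positivity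
  obtain ⟨r₀, hr₀⟩ : ∃ r₀, r₀ = Real.exp (-L₀) := ⟨_, rfl⟩
  have hr₀pos : 0 < r₀ := hr₀ ▸ Real.exp_pos _
  have hr₀1 : r₀ ≤ 1 := by rw [hr₀, Real.exp_le_one_iff]; linarith
  have key : ∃ δ > 0, ∀ r > 0, δ ≤ (lam + ∫ α in Ioo (0:ℝ) 1, r ^ α * Real.cos (π * α) * μ α) ^ 2 +
      (∫ α in Ioo (0:ℝ) 1, r ^ α * Real.sin (π * α) * μ α) ^ 2 := by
    refine ⟨min ((lam / 2) ^ 2) ((r₀ * s) ^ 2), by positivity, fun r hr => ?_⟩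
    rcases le_total r r₀ with h | h
    · have hL : L₀ ≤ -Real.log r := by
        have := Real.log_le_log hr h
        rw [hr₀, Real.log_exp] at this
        linarith
      have hc := abs_integral_rpow_mul_cos_le hnn hf1 (hL₀pos.trans_le hL)
      rw [neg_neg, Real.exp_log hr, ← hd] at hc
      have hdL : d / -Real.log r ≤ lam / 2 := by
        rw [div_le_iff₀ (hL₀pos.trans_le hL)]
        have : lam * L₀ = 2 * d + lam := by rw [hL₀]; field_simp
        nlinarith
      have hc' := neg_le_of_abs_le (hc.trans hdL)
      have h2 : (lam / 2) ^ 2 ≤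
          (lam + ∫ α in Ioo (0:ℝ) 1, r ^ α * Real.cos (π * α) * μ α) ^ 2 := by
        gcongr
        linarith
      exact (min_le_left _ _).trans (h2.trans (le_add_of_nonneg_right (sq_nonneg _)))
    · have hS : r₀ * s ≤ ∫ α in Ioo (0:ℝ) 1, r ^ α * Real.sin (π * α) * μ α := by
        rw [hsdef, ← integral_const_mul]
        have hi (ρ : ℝ) (hρ : 0 < ρ) := integrableOn_rpow_mul_mul hint
          (g := fun α => Real.sin (π * α)) (by fun_prop) (fun α => Real.abs_sin_le_one _) hρ
        refine setIntegral_mono_on ?_ (hi r hr) measurableSet_Ioo fun α hα => ?_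
        · simpa [IntegrableOn] using (hi 1 one_pos).const_mul r₀
        · rw [mul_assoc]
          refine mul_le_mul_of_nonneg_right ?_
            (mul_nonneg (sin_pi_mul_pos hα).le (hnn α (Ioo_subset_Icc_self hα)))
          calc r₀ = r₀ ^ (1:ℝ) := (Real.rpow_one _).symm
            _ ≤ r₀ ^ α := Real.rpow_le_rpow_of_exponent_ge hr₀pos hr₀1 hα.2.le
            _ ≤ r ^ α := Real.rpow_le_rpow hr₀pos.le h hα.1.le
      have h2 : (r₀ * s) ^ 2 ≤ (∫ α in Ioo (0:ℝ) 1, r ^ α * Real.sin (π * α) * μ α) ^ 2 := by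
        gcongr
      exact (min_le_right _ _).trans (h2.trans (le_add_of_nonneg_left (sq_nonneg _)))
  obtain ⟨δ, hδ, hkey⟩ := key
  refine ⟨1 / δ, by positivity, fun r hr => ?_⟩
  rw [one_div_mul_eq_div]
  exact div_le_div_of_nonneg_left (integral_rpow_mul_sin_nonneg hnn hr) hδ (hkey r hr)

theorem integral_rpow_sub_one_mul_exp {α t : ℝ} (hα : 0 < α) (ht : 0 < t) :
    ∫ r in Ioi (0:ℝ), r ^ (α - 1) * Real.exp (-(t * r)) = t ^ (-α) * Real.Gamma α := by
  rw [Real.integral_rpow_mul_exp_neg_mul_Ioi hα ht, one_div, Real.inv_rpow ht.le,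
    Real.rpow_neg ht.le]

theorem integrable_laplace_kernel {μ : ℝ → ℝ} (hmeas : Measurable μ)
    (hnn : ∀ α ∈ Icc (0:ℝ) 1, 0 ≤ μ α) (hint : IntegrableOn μ (Ioo 0 1)) {t : ℝ} (ht : 1 ≤ t) :
    Integrable (Function.uncurry fun α r : ℝ =>
        r ^ (α - 1) * Real.exp (-(t * r)) * (Real.sin (π * α) * μ α))
      ((volume.restrict (Ioo 0 1)).prod (volume.restrict (Ioi 0))) := by
  have ht0 : 0 < t := one_pos.trans_le ht
  have hm : AEStronglyMeasurable (Function.uncurry fun α r : ℝ =>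
        r ^ (α - 1) * Real.exp (-(t * r)) * (Real.sin (π * α) * μ α))
      ((volume.restrict (Ioo 0 1)).prod (volume.restrict (Ioi 0))) := by
    refine Measurable.aestronglyMeasurable ?_
    unfold Function.uncurry
    fun_prop
  refine (integrable_prod_iff hm).2 ⟨?_, ?_⟩
  · filter_upwards [ae_restrict_mem measurableSet_Ioo] with α hα
    exact (integrableOn_rpow_mul_exp_neg_mul (s := α - 1) (by linarith [hα.1]) ht0).mul_const
      (Real.sin (π * α) * μ α)
  · refine Integrable.mono' (hint.const_mul π) hm.norm.integral_prod_right' ?_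
    filter_upwards [ae_restrict_mem measurableSet_Ioo] with α hα
    have hμ := hnn α (Ioo_subset_Icc_self hα)
    have hsin := (sin_pi_mul_pos hα).le
    have : ∫ r in Ioi (0:ℝ), ‖Function.uncurry (fun α r : ℝ =>
        r ^ (α - 1) * Real.exp (-(t * r)) * (Real.sin (π * α) * μ α)) (α, r)‖ =
        t ^ (-α) * Real.Gamma α * (Real.sin (π * α) * μ α) := by
      rw [← integral_rpow_sub_one_mul_exp hα.1 ht0, ← integral_mul_const]
      refine setIntegral_congr_fun measurableSet_Ioi fun r hr => ?_
      have hr' : 0 < r := hr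
      exact Real.norm_of_nonneg (by simp only [Function.uncurry]; positivity)
    have hΓ := (Real.Gamma_pos_of_pos hα.1).le
    rw [this, Real.norm_of_nonneg (by positivity)]
    calc t ^ (-α) * Real.Gamma α * (Real.sin (π * α) * μ α)
        = t ^ (-α) * (Real.sin (π * α) * Real.Gamma α) * μ α := by ring
      _ ≤ 1 * π * μ α := by
        gcongr
        · exact Real.rpow_le_one_of_one_le_of_nonpos ht (by linarith [hα.1])
        · exact sin_pi_mul_mul_Gamma_le hα
      _ = π * μ α := by ring

theorem integrableOn_rpow_neg_mul {μ : ℝ → ℝ} (hint : IntegrableOn μ (Ioo 0 1)) {t : ℝ}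
    (ht : 0 < t) : IntegrableOn (fun α => t ^ (-α) * μ α) (Ioo 0 1) := by
  have := integrableOn_rpow_mul_mul hint (g := fun _ => 1) measurable_const (by simp)
    (inv_pos.2 ht)
  simpa [Real.inv_rpow ht.le, Real.rpow_neg ht.le] using this

theorem integral_laplace_kernel_le {μ : ℝ → ℝ} (hmeas : Measurable μ)
    (hnn : ∀ α ∈ Icc (0:ℝ) 1, 0 ≤ μ α) (hint : IntegrableOn μ (Ioo 0 1)) {t : ℝ} (ht : 1 ≤ t) :
    ∫ r in Ioi (0:ℝ), ∫ α in Ioo (0:ℝ) 1,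
        r ^ (α - 1) * Real.exp (-(t * r)) * (Real.sin (π * α) * μ α) ≤
      π * ∫ α in Ioo (0:ℝ) 1, t ^ (-α) * μ α := by
  have ht0 : 0 < t := one_pos.trans_le ht
  have hF := integrable_laplace_kernel hmeas hnn hint ht
  rw [← integral_integral_swap hF, ← integral_const_mul]
  refine setIntegral_mono_on hF.integral_prod_left
    ((integrableOn_rpow_neg_mul hint ht0).const_mul π) measurableSet_Ioo fun α hα => ?_
  have hμ := hnn α (Ioo_subset_Icc_self hα)
  rw [integral_mul_const, integral_rpow_sub_one_mul_exp hα.1 ht0]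
  calc t ^ (-α) * Real.Gamma α * (Real.sin (π * α) * μ α)
      = (Real.sin (π * α) * Real.Gamma α) * (t ^ (-α) * μ α) := by ring
    _ ≤ π * (t ^ (-α) * μ α) := by
      gcongr
      exact sin_pi_mul_mul_Gamma_le hα

/-- `v` is controlled by the Laplace transform of `μ` at `log t`. -/
theorem exists_abs_vfun_le {μ : ℝ → ℝ} {lam : ℝ} (hlam : 0 < lam) (v₀ : ℝ) (hmeas : Measurable μ)
    (hnn : ∀ α ∈ Icc (0:ℝ) 1, 0 ≤ μ α) (hint : IntegrableOn μ (Ioo 0 1))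
    (hpos : 0 < ∫ α in Ioo (0:ℝ) 1, μ α)
    (hf1 : IntegrableOn (fun α => μ α / α) (Ioo 0 1)) :
    ∃ B > 0, ∀ t ≥ 1, |vfun μ lam v₀ t| ≤ B * ∫ α in Ioo (0:ℝ) 1, t ^ (-α) * μ α := by
  obtain ⟨A, hA, hG⟩ := exists_Gfun_le hlam hnn hint hpos hf1
  refine ⟨|v₀ * (lam / π)| * (A * π) + 1, by positivity, fun t ht => ?_⟩
  have ht0 : 0 < t := one_pos.trans_le ht
  have hI : 0 ≤ ∫ α in Ioo (0:ℝ) 1, t ^ (-α) * μ α :=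
    setIntegral_nonneg measurableSet_Ioo fun α hα =>
      mul_nonneg (Real.rpow_nonneg ht0.le _) (hnn α (Ioo_subset_Icc_self hα))
  have h1 : |∫ r in Ioi (0:ℝ), (Real.exp (-r * t) / r) * Gfun μ lam r| ≤
      A * (π * ∫ α in Ioo (0:ℝ) 1, t ^ (-α) * μ α) := by
    refine le_trans ?_
      (mul_le_mul_of_nonneg_left (integral_laplace_kernel_le hmeas hnn hint ht) hA.le)
    rw [← integral_const_mul, ← Real.norm_eq_abs]
    refine norm_integral_le_of_norm_le
      ((integrable_laplace_kernel hmeas hnn hint ht).integral_prod_right.const_mul A) ?_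
    filter_upwards [ae_restrict_mem measurableSet_Ioi] with r hr
    have hr' : 0 < r := hr
    rw [Real.norm_of_nonneg (mul_nonneg (by positivity) (Gfun_nonneg hnn lam hr'))]
    calc Real.exp (-r * t) / r * Gfun μ lam r
        ≤ Real.exp (-r * t) / r * (A * ∫ α in Ioo (0:ℝ) 1, r ^ α * Real.sin (π * α) * μ α) := by
          gcongr
          exact hG r hr'
      _ = A * ∫ α in Ioo (0:ℝ) 1, Real.exp (-r * t) / r * (r ^ α * Real.sin (π * α) * μ α) := by
          rw [integral_const_mul]; ring
      _ = _ := by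
          congr 1
          refine integral_congr_ae (ae_of_all _ fun α => ?_)
          simp only
          rw [Real.rpow_sub_one hr'.ne', show -r * t = -(t * r) by ring]
          ring
  rw [vfun, abs_mul]
  calc |v₀ * (lam / π)| * |∫ r in Ioi (0:ℝ), (Real.exp (-r * t) / r) * Gfun μ lam r|
      ≤ |v₀ * (lam / π)| * (A * (π * ∫ α in Ioo (0:ℝ) 1, t ^ (-α) * μ α)) := by gcongr
    _ ≤ _ := by linarith

/-- Weighted AM-GM: the minimum over `α` of `x α + β / α ^ m`. -/
theorem stretched_exponent_le {m β q L α : ℝ} (hm : 0 < m) (hβ : 0 < β) (hq : 0 < q) (hL : 0 < L)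
    (hα : 0 < α) :
    m ^ (1 / (m + 1)) * (1 + 1 / m) * (q ^ m * β) ^ (1 / (m + 1)) * L ^ (m / (m + 1)) ≤
      q * L * α + β / α ^ m := by
  have h := Real.geom_mean_le_arith_mean2_weighted (w₁ := m / (m + 1)) (w₂ := 1 / (m + 1))
    (p₁ := q * L * α * ((m + 1) / m)) (p₂ := β / α ^ m * (m + 1)) (by positivity) (by positivity)
    (by positivity) (by positivity) (by field_simp)
  convert h using 1
  · apply Real.log_injOn_pos (show _ ∈ Ioi (0:ℝ) from mem_Ioi.2 (by positivity))
      (show _ ∈ Ioi (0:ℝ) from mem_Ioi.2 (by positivity))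
    rw [show 1 + 1 / m = (m + 1) / m by field_simp]
    repeat rw [Real.log_mul (by positivity) (by positivity)]
    repeat rw [Real.log_rpow (by positivity)]
    repeat rw [Real.log_mul (by positivity) (by positivity)]
    repeat rw [Real.log_div (by positivity) (by positivity)]
    repeat rw [Real.log_rpow (by positivity)]
    field_simp
    ring
  · field_simp

theorem integral_rpow_neg_mul_le {μ : ℝ → ℝ}
    (hnn : ∀ α ∈ Icc (0:ℝ) 1, 0 ≤ μ α) (hint : IntegrableOn μ (Ioo 0 1))
    {ϑ κ a β m q t K : ℝ} (hϑ : ϑ ∈ Ioo (0:ℝ) 1) (hκ : 0 < κ) (ha : 0 < a) (hq : q < 1)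
    (ht : 1 < t) (hK : ∀ α > 0, K ≤ q * Real.log t * α + β / α ^ m)
    (hμbound : ∀ᵐ α ∂(volume.restrict (Ioo 0 ϑ)),
      μ α ≤ a * α ^ κ * Real.exp (-β / α ^ m)) :
    ∫ α in Ioo (0:ℝ) 1, t ^ (-α) * μ α ≤
      a * (Real.Gamma (κ + 1) / ((1 - q) ^ (κ + 1) * Real.log t ^ (κ + 1))) * Real.exp (-K) +
        Real.exp (-(ϑ * Real.log t)) * ∫ α in Ioo (0:ℝ) 1, μ α := by
  have hL := Real.log_pos ht
  have ht0 : 0 < t := one_pos.trans ht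
  set L := Real.log t with hLdef
  have hpow (α : ℝ) : t ^ (-α) = Real.exp (-(L * α)) := by
    rw [Real.rpow_def_of_pos ht0, mul_neg]
  have hi := integrableOn_rpow_neg_mul hint ht0
  have hb : 0 < (1 - q) * L := mul_pos (sub_pos.2 hq) hL
  rw [← Ioo_union_Ico_eq_Ioo hϑ.1 hϑ.2.le] at hi
  have hnear : ∫ α in Ioo (0:ℝ) ϑ, t ^ (-α) * μ α ≤
      a * (Real.Gamma (κ + 1) / ((1 - q) ^ (κ + 1) * L ^ (κ + 1))) * Real.exp (-K) := by
    have hint' : IntegrableOn (fun α => a * Real.exp (-K) *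
        (α ^ κ * Real.exp (-((1 - q) * L * α)))) (Ioi 0) := ((integrableOn_rpow_mul_exp_neg_mul (s := κ) (by linarith) hb).const_mul
      (a * Real.exp (-K)))
    calc ∫ α in Ioo (0:ℝ) ϑ, t ^ (-α) * μ α
        ≤ ∫ α in Ioo (0:ℝ) ϑ, a * Real.exp (-K) * (α ^ κ * Real.exp (-((1 - q) * L * α))) := by
          refine integral_mono_ae hi.left_of_union (hint'.mono_set Ioo_subset_Ioi_self) ?_
          filter_upwards [hμbound, ae_restrict_mem measurableSet_Ioo] with α hα hmem
          have h0 := hmem.1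
          calc t ^ (-α) * μ α
              ≤ Real.exp (-(L * α)) * (a * α ^ κ * Real.exp (-β / α ^ m)) := by
                rw [hpow]; gcongr
            _ = a * α ^ κ * Real.exp (-(L * α) + -β / α ^ m) := by rw [Real.exp_add]; ring
            _ ≤ a * α ^ κ * Real.exp (-K + -((1 - q) * L * α)) := by
                refine mul_le_mul_of_nonneg_left (Real.exp_le_exp.2 ?_) (by positivity)
                have := hK α h0
                rw [neg_div]
                linarith
            _ = a * Real.exp (-K) * (α ^ κ * Real.exp (-((1 - q) * L * α))) := by
                rw [Real.exp_add]; ring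
      _ ≤ ∫ α in Ioi (0:ℝ), a * Real.exp (-K) * (α ^ κ * Real.exp (-((1 - q) * L * α))) := by
          refine setIntegral_mono_set hint' ?_ Ioo_subset_Ioi_self.eventuallyLE
          filter_upwards [ae_restrict_mem measurableSet_Ioi] with α hα
          have h0 : 0 < α := hα
          simp only [Pi.zero_apply]
          positivity
      _ = _ := by
          have h := Real.integral_rpow_mul_exp_neg_mul_Ioi (a := κ + 1) (by linarith) hb
          rw [add_sub_cancel_right] at h
          rw [integral_const_mul, h, one_div, Real.inv_rpow hb.le,
            Real.mul_rpow (sub_pos.2 hq).le hL.le]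
          ring
  have hfar : ∫ α in Ico ϑ 1, t ^ (-α) * μ α ≤
      Real.exp (-(ϑ * L)) * ∫ α in Ioo (0:ℝ) 1, μ α := by
    have hsub : Ico ϑ 1 ⊆ Ioo 0 1 := fun α hα => ⟨hϑ.1.trans_le hα.1, hα.2⟩
    have hc : IntegrableOn (fun α => Real.exp (-(ϑ * L)) * μ α) (Ioo 0 1) :=
      hint.const_mul _
    rw [← integral_const_mul]
    refine (setIntegral_mono_on hi.right_of_union (hc.mono_set hsub) measurableSet_Ico
      fun α hα => ?_).trans (setIntegral_mono_set hc ?_ hsub.eventuallyLE)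
    · refine mul_le_mul_of_nonneg_right ?_ (hnn α (Ioo_subset_Icc_self (hsub hα)))
      rw [hpow, Real.exp_le_exp]
      nlinarith [hα.1]
    · filter_upwards [ae_restrict_mem measurableSet_Ioo] with α hα
      exact mul_nonneg (Real.exp_pos _).le (hnn α (Ioo_subset_Icc_self hα))
  calc ∫ α in Ioo (0:ℝ) 1, t ^ (-α) * μ α
      = (∫ α in Ioo (0:ℝ) ϑ, t ^ (-α) * μ α) + ∫ α in Ico ϑ 1, t ^ (-α) * μ α := by
        rw [← Ioo_union_Ico_eq_Ioo hϑ.1 hϑ.2.le]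
        refine setIntegral_union ?_ measurableSet_Ico hi.left_of_union hi.right_of_union
        exact Set.disjoint_left.2 fun α h1 h2 => absurd h1.2 (not_lt.2 h2.1)
    _ ≤ _ := add_le_add hnear hfar

/-- An exponential is eventually below a stretched exponential times a negative power. -/
theorem eventually_exp_neg_mul_le {ϑ p s K : ℝ} (hϑ : 0 < ϑ) (hp : p < 1) :
    ∀ᶠ L in Filter.atTop, Real.exp (-(ϑ * L)) ≤ 1 / L ^ s * Real.exp (-(K * L ^ p)) := by
  have h1 := (tendsto_rpow_mul_exp_neg_mul_atTop_nhds_zero s (ϑ / 2) (by positivity)).eventually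
    (Iic_mem_nhds one_pos)
  have h2 : Filter.Tendsto (fun L : ℝ => K * L ^ (-(1 - p))) Filter.atTop (nhds (K * 0)) :=
    (tendsto_rpow_neg_atTop (sub_pos.2 hp)).const_mul K
  rw [mul_zero] at h2
  filter_upwards [h1, h2.eventually (Iic_mem_nhds (half_pos hϑ)), Filter.eventually_gt_atTop 0]
    with L hL1 hL2 hL
  have hK : K * L ^ p ≤ ϑ / 2 * L := by
    have h := mul_le_mul_of_nonneg_right hL2 hL.le
    rwa [mul_assoc, ← Real.rpow_add_one hL.ne', show -(1 - p) + 1 = p by ring] at h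
  have hs : 0 < L ^ s := Real.rpow_pos_of_pos hL s
  calc Real.exp (-(ϑ * L)) = Real.exp (-(ϑ / 2) * L) * Real.exp (-(ϑ / 2 * L)) := by
        rw [← Real.exp_add]; ring_nf
    _ ≤ 1 / L ^ s * Real.exp (-(K * L ^ p)) := by
        gcongr
        rw [le_div_iff₀ hs]
        linarith

/-- estimates (f12)-(f13): if `μ(α) ≤ a α^κ e^{-β/α^m}` a.e. near `0`,
then for every `q ∈ (0,1)`, `|v(t)|` is bounded by the stretched-exponential
logarithmic rate. -/
theorem v_stretched_exp_decay (μ : ℝ → ℝ) (lam v₀ : ℝ) (hlam : 0 < lam)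
    (hmeas : Measurable μ)
    (hnn : ∀ α ∈ Icc (0:ℝ) 1, 0 ≤ μ α)
    (hint : IntegrableOn μ (Ioo 0 1))
    (hpos : 0 < ∫ α in Ioo (0:ℝ) 1, μ α)
    (hf1 : IntegrableOn (fun α => μ α / α) (Ioo 0 1))
    (ϑ : ℝ) (hϑ : ϑ ∈ Ioo (0:ℝ) 1) (κ a β m : ℝ)
    (hκ : 0 < κ) (ha : 0 < a) (hβ : 0 < β) (hm : 0 < m)
    (hμbound : ∀ᵐ α ∂(volume.restrict (Ioo 0 ϑ)),
      μ α ≤ a * α ^ κ * Real.exp (-β / α ^ m)) :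
    ∀ q ∈ Ioo (0:ℝ) 1, ∃ c > 0, ∃ T₀ > (1:ℝ), ∀ t ≥ T₀,
      |vfun μ lam v₀ t| ≤
        c * Real.Gamma (κ + 1) / ((1 - q) ^ (κ + 1) * Real.log t ^ (κ + 1)) *
          Real.exp (-(m ^ (1 / (m + 1)) * (1 + 1 / m) *
            (q ^ m * β) ^ (1 / (m + 1)) * Real.log t ^ (m / (m + 1)))) := by
  rintro q ⟨hq0, hq1⟩
  obtain ⟨B, hB, hv⟩ := exists_abs_vfun_le hlam v₀ hmeas hnn hint hpos hf1
  set M := ∫ α in Ioo (0:ℝ) 1, μ α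
  have hΓ : 0 < Real.Gamma (κ + 1) := Real.Gamma_pos_of_pos (by linarith)
  have hp : m / (m + 1) < 1 := by rw [div_lt_one (by positivity)]; linarith
  obtain ⟨T, hT⟩ := Filter.eventually_atTop.1 (Real.tendsto_log_atTop.eventually
    (eventually_exp_neg_mul_le (s := κ + 1)
      (K := m ^ (1 / (m + 1)) * (1 + 1 / m) * (q ^ m * β) ^ (1 / (m + 1))) hϑ.1 hp))
  refine ⟨B * (a + M / Real.Gamma (κ + 1)), by positivity, max T 2,
    lt_max_of_lt_right one_lt_two, fun t ht => ?_⟩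
  have ht1 : 1 < t := one_lt_two.trans_le ((le_max_right _ _).trans ht)
  have hL := Real.log_pos ht1
  have hfar := hT t ((le_max_left _ _).trans ht)
  have hmain := integral_rpow_neg_mul_le hnn hint hϑ hκ ha hq1 ht1
    (fun α hα => stretched_exponent_le hm hβ hq0 hL hα) hμbound
  set E := Real.exp (-(m ^ (1 / (m + 1)) * (1 + 1 / m) *
            (q ^ m * β) ^ (1 / (m + 1)) * Real.log t ^ (m / (m + 1))))
  have hE : 0 < E := Real.exp_pos _
  set L := Real.log t
  have hLp : 0 < L ^ (κ + 1) := Real.rpow_pos_of_pos hL _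
  have hq' : 0 < 1 - q := sub_pos.2 hq1
  have hqp : 0 < (1 - q) ^ (κ + 1) := Real.rpow_pos_of_pos hq' _
  have hq1' : (1 - q) ^ (κ + 1) ≤ 1 := Real.rpow_le_one hq'.le (by linarith) (by linarith)
  have hfar' : Real.exp (-(ϑ * L)) ≤ 1 / ((1 - q) ^ (κ + 1) * L ^ (κ + 1)) * E := by
    refine hfar.trans (mul_le_mul_of_nonneg_right ?_ hE.le)
    exact one_div_le_one_div_of_le (by positivity) (mul_le_of_le_one_left hLp.le hq1')
  calc |vfun μ lam v₀ t| ≤ B * ∫ α in Ioo (0:ℝ) 1, t ^ (-α) * μ α := hv t ht1.le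
    _ ≤ B * (a * (Real.Gamma (κ + 1) / ((1 - q) ^ (κ + 1) * L ^ (κ + 1))) * E +
        1 / ((1 - q) ^ (κ + 1) * L ^ (κ + 1)) * E * M) := by
      gcongr
      exact hmain.trans (by gcongr)
    _ = _ := by field_simp
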